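/- Let M ≥ 3 and V ≥ 3 be integers and let v_1, …, v_{3M} be positive integers satisfying V < 4·v_i and 2·v_i < V for every i, and ∑_{i=1}^{3M} v_i = M·V. Then the following are equivalent: (1) there exists a function f from {1,…,3M} to {1,…,M} such that for every j ∈ {1,…,M} the sum of v_i over all i with f(i) = j equals V; (2) there exists a function g from {1,…,3M} to {1,…,M} such that ∑_{j=1}^{M} R(V, ∑_{i : g(i)=j} v_i) > M·(4V+1) − V. -/

import Mathlib

def R (V w : ℕ) : ℤ := (V : ℤ) + 1 + w + ⌈((V : ℚ) + 1 + (w : ℚ)) / (2 * V)⌉ * V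

lemma two_mul_ceil_sub_one_le {V : ℕ} (hV : 0 < V) (w : ℕ) :
    2 * V * (⌈((V : ℚ) + 1 + (w : ℚ)) / (2 * V)⌉ - 1) ≤ (V : ℤ) + w := by
  have hV' : (0 : ℚ) < 2 * V := by positivity
  have h := Int.ceil_lt_add_one (((V : ℚ) + 1 + (w : ℚ)) / (2 * V))
  rw [← sub_lt_iff_lt_add, lt_div_iff₀ hV'] at h
  have h' : (⌈((V : ℚ) + 1 + (w : ℚ)) / (2 * V)⌉ - 1) * (2 * V) < (V : ℤ) + 1 + w := by
    exact_mod_cast h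
  linarith

lemma R_le {V : ℕ} (hV : 0 < V) (w : ℕ) : R V w ≤ 2 * V + 1 + 2 * w := by
  have h := two_mul_ceil_sub_one_le hV w
  unfold R
  set c := ⌈((V : ℚ) + 1 + (w : ℚ)) / (2 * V)⌉
  have hV' : (0 : ℤ) < V := by exact_mod_cast hV
  rcases le_or_gt c 1 with hc | hc <;> nlinarith

lemma dvd_R_sub (V w : ℕ) : (V : ℤ) ∣ R V w - 1 - w :=
  ⟨1 + ⌈((V : ℚ) + 1 + (w : ℚ)) / (2 * V)⌉, by unfold R; ring⟩

lemma le_of_R_eq {V : ℕ} (hV : 2 ≤ V) {w : ℕ} (h : R V w = 2 * V + 1 + 2 * w) : w ≤ V := by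
  have hb := two_mul_ceil_sub_one_le (V := V) (by omega) w
  unfold R at h
  set c := ⌈((V : ℚ) + 1 + (w : ℚ)) / (2 * V)⌉
  zify
  nlinarith

lemma R_self {V : ℕ} (hV : 0 < V) : R V V = 4 * V + 1 := by
  have hV' : (1 : ℚ) ≤ V := by exact_mod_cast hV
  have hc : ⌈((V : ℚ) + 1 + (V : ℚ)) / (2 * V)⌉ = 2 := by
    rw [Int.ceil_eq_iff, lt_div_iff₀ (by positivity), div_le_iff₀ (by positivity)]
    constructor <;> push_cast <;> linarith
  rw [R, hc]
  ring

lemma eq_of_lt_sum_R {ι : Type*} [Fintype ι] {V : ℕ} (hV : 2 ≤ V) (w : ι → ℕ)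
    (hw : ∑ j, w j = Fintype.card ι * V)
    (h : (Fintype.card ι : ℤ) * (4 * V + 1) - V < ∑ j, R V (w j)) (j : ι) : w j = V := by
  have hV0 : 0 < V := by omega
  have hwz : ∑ j, (w j : ℤ) = Fintype.card ι * V := by exact_mod_cast hw
  have hbound : ∑ j, (2 * (V : ℤ) + 1 + 2 * w j) = Fintype.card ι * (4 * V + 1) := by
    rw [Finset.sum_add_distrib, ← Finset.mul_sum, hwz]
    simp only [Finset.sum_const, Finset.card_univ, nsmul_eq_mul]
    ring
  have hsum : ∑ j, R V (w j) = ∑ j, (2 * (V : ℤ) + 1 + 2 * w j) := by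
    have hle := Finset.sum_le_sum fun j (_ : j ∈ Finset.univ) => R_le hV0 (w j)
    have hdvd : (V : ℤ) ∣ ∑ j, (2 * (V : ℤ) + 1 + 2 * w j) - ∑ j, R V (w j) := by
      have h1 := Finset.dvd_sum fun j (_ : j ∈ Finset.univ) => dvd_R_sub V (w j)
      simp only [Finset.sum_sub_distrib, hwz, Finset.sum_const, Finset.card_univ,
        nsmul_eq_mul] at h1
      have h2 : (V : ℤ) ∣ 3 * Fintype.card ι * V := dvd_mul_left _ _
      rw [hbound]
      have h3 := dvd_sub h2 h1
      ring_nf at h3 ⊢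
      exact h3
    have := Int.eq_zero_of_dvd_of_nonneg_of_lt (by linarith) (by linarith) hdvd
    linarith
  have heq := (Finset.sum_eq_sum_iff_of_le fun j _ => R_le hV0 (w j)).1 hsum
  have hle : ∀ j ∈ Finset.univ, w j ≤ V := fun j hj => le_of_R_eq hV (heq j hj)
  exact (Finset.sum_eq_sum_iff_of_le hle).1 (by simp [hw]) j (Finset.mem_univ j)

theorem stmt8 (M V : ℕ) (hM : 3 ≤ M) (hV : 3 ≤ V) (v : Fin (3 * M) → ℕ)
    (hpos : ∀ i, 0 < v i) (hlo : ∀ i, V < 4 * v i) (hhi : ∀ i, 2 * v i < V)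
    (hsum : ∑ i, v i = M * V) :
    (∃ f : Fin (3 * M) → Fin M,
        ∀ j, ∑ i ∈ Finset.univ.filter (fun i => f i = j), v i = V) ↔
    (∃ g : Fin (3 * M) → Fin M,
        (M : ℤ) * (4 * V + 1) - V <
          ∑ j, R V (∑ i ∈ Finset.univ.filter (fun i => g i = j), v i)) := by
  constructor
  · rintro ⟨f, hf⟩
    refine ⟨f, ?_⟩
    simp only [hf, R_self (by omega : 0 < V), Finset.sum_const, Finset.card_univ,
      Fintype.card_fin, nsmul_eq_mul]
    omega
  · rintro ⟨g, hg⟩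
    refine ⟨g, eq_of_lt_sum_R (by omega) _ ?_ (by simpa using hg)⟩
    rw [Finset.sum_fiberwise, hsum, Fintype.card_fin]
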